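/- arXiv:0807.4361 — 2 statements merged into one kernel-verified Lean document; each statement's English description precedes it below -/
import Mathlib

section
/- Let H be a complex Hilbert space and let A be a norm-closed *-subalgebra of B(H) (a concrete C*-algebra) which is infinite-dimensional over ℂ and separable as a topological space. Let M = A'' be the double commutant of A in B(H), i.e. the von Neumann algebra generated by A. Then A is not complemented in M: there is no bounded linear map P : M → M whose range is contained in A and which satisfies P(a) = a for every a ∈ A. -/
section CStarAlgebra

variable {A : Type*} [CStarAlgebra A]

/-- A self-adjoint element with infinite spectrum yields infinitely many pairwise orthogonal
nonzero self-adjoint elements. -/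
theorem IsSelfAdjoint.exists_orthogonal_seq_of_infinite_spectrum {x : A} (hx : IsSelfAdjoint x)
    (hinf : (spectrum ℝ x).Infinite) :
    ∃ a : ℕ → A, (∀ n, IsSelfAdjoint (a n)) ∧ (∀ n, a n ≠ 0) ∧
      Pairwise fun m n ↦ a m * a n = 0 := by
  have := hinf.to_subtype
  obtain ⟨U, hU, hUo, hUd⟩ := exists_seq_infinite_isOpen_pairwise_disjoint (spectrum ℝ x)
  choose V hVo hVU using fun n ↦ isOpen_induced_iff.1 (hUo n)
  choose t ht using fun n ↦ (hU n).nonempty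
  have htV (n : ℕ) : (t n : ℝ) ∈ V n := by
    have := ht n
    rwa [← hVU n] at this
  have hf (n : ℕ) : ∃ f : C(ℝ, ℝ), Set.EqOn f 0 (V n)ᶜ ∧ f (t n) = 1 := by
    obtain ⟨f, hf0, hf1, -⟩ := exists_continuous_zero_one_of_isClosed (hVo n).isClosed_compl
      (isClosed_singleton (x := (t n : ℝ)))
      (Set.disjoint_singleton_right.2 fun h ↦ h (htV n))
    exact ⟨f, hf0, hf1 rfl⟩
  choose f hf0 hf1 using hf
  refine ⟨fun n ↦ cfc (f n) x, fun n ↦ cfc_predicate _ _, fun n h ↦ ?_, fun m n hmn ↦ ?_⟩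
  · have h' : cfc (f n) x = cfc (fun _ ↦ (0 : ℝ)) x := by simpa using h
    have := (cfc_eq_cfc_iff_eqOn (R := ℝ) (a := x) (f := f n)).1 h' (t n).2
    simp [hf1] at this
  · beta_reduce
    rw [← cfc_mul (f m) (f n) x (f m).continuous.continuousOn (f n).continuous.continuousOn]
    have : (spectrum ℝ x).EqOn (fun s ↦ f m s * f n s) (fun _ ↦ 0) := by
      intro s hs
      by_cases hm : s ∈ V m
      · by_cases hn : s ∈ V n
        · have hm' : (⟨s, hs⟩ : spectrum ℝ x) ∈ U m := by rwa [← hVU m]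
          have hn' : (⟨s, hs⟩ : spectrum ℝ x) ∈ U n := by rwa [← hVU n]
          exact absurd hn' (Set.disjoint_left.1 (hUd hmn) hm')
        · simp [hf0 n hn]
      · simp [hf0 m hm]
    rw [cfc_congr this]
    simp

/-- A nonzero self-adjoint element with finite spectrum has a nonzero spectral projection for a
nonzero eigenvalue. -/
theorem IsSelfAdjoint.exists_spectral_projection_of_finite_spectrum {x : A} (hx : IsSelfAdjoint x)
    (hx0 : x ≠ 0) (hfin : (spectrum ℝ x).Finite) :
    ∃ (t : ℝ) (q : A), t ≠ 0 ∧ IsStarProjection q ∧ q ≠ 0 ∧ x * q = t • q ∧ q * x = t • q := by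
  obtain ⟨t, ht, ht0⟩ : ∃ t ∈ spectrum ℝ x, t ≠ 0 := by
    by_contra! h
    apply hx0
    rw [← cfc_id ℝ x, cfc_congr (f := id) (g := fun _ ↦ 0) fun s hs ↦ h s hs]
    simp
  have hc (g : ℝ → ℝ) : ContinuousOn g (spectrum ℝ x) := hfin.continuousOn g
  set e : ℝ → ℝ := fun s ↦ if s = t then 1 else 0 with he
  refine ⟨t, cfc e x, ht0, ⟨?_, cfc_predicate _ _⟩, fun h ↦ ?_, ?_, ?_⟩
  · rw [IsIdempotentElem, ← cfc_mul e e x (hc _) (hc _)]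
    congr 1
    ext s
    simp [he]
  · have h' : cfc e x = cfc (fun _ ↦ (0 : ℝ)) x := by simpa using h
    have := (cfc_eq_cfc_iff_eqOn (R := ℝ) (a := x) (f := e) (hf := hc _)).1 h' ht
    simp [he] at this
  · nth_rewrite 1 [← cfc_id ℝ x]
    rw [← cfc_mul id e x (hc _) (hc _), ← cfc_smul t e x (hc _)]
    congr 1
    ext s
    by_cases h : s = t <;> simp [he, h]
  · nth_rewrite 2 [← cfc_id ℝ x]
    rw [← cfc_mul e id x (hc _) (hc _), ← cfc_smul t e x (hc _)]
    congr 1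
    ext s
    by_cases h : s = t <;> simp [he, h]

/-- In the absence of infinite orthogonal sequences, there are no infinite strictly decreasing
sequences of projections. -/
theorem wellFounded_isStarProjection_of_no_orthogonal_seq
    (h : ¬ ∃ a : ℕ → A, (∀ n, IsSelfAdjoint (a n)) ∧ (∀ n, a n ≠ 0) ∧
      Pairwise fun m n ↦ a m * a n = 0) :
    WellFounded fun q p : {p : A // IsStarProjection p} ↦ (q : A) * p = q ∧ q ≠ p := by
  rw [wellFounded_iff_isEmpty_descending_chain]
  refine ⟨fun ⟨p, hp⟩ ↦ h ⟨fun n ↦ (p n : A) - p (n + 1), fun n ↦ ?_, fun n h0 ↦ ?_, ?_⟩⟩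
  · exact (p n).2.isSelfAdjoint.sub (p (n + 1)).2.isSelfAdjoint
  · exact (hp n).2 (Subtype.ext (sub_eq_zero.1 h0).symm)
  · have hle (m k : ℕ) : (p (m + k) : A) * p m = p (m + k) := by
      induction k with
      | zero => exact (p m).2.isIdempotentElem
      | succ k ih =>
        have h1 := (hp (m + k)).1
        rw [← add_assoc, ← h1, mul_assoc, ih]
    have hle' (m k : ℕ) : (p m : A) * p (m + k) = p (m + k) := by
      have := congrArg star (hle m k)
      rwa [star_mul, (p m).2.isSelfAdjoint.star_eq, (p (m + k)).2.isSelfAdjoint.star_eq] at this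
    have key (m k : ℕ) : ((p m : A) - p (m + 1)) * (p (m + 1 + k) - p (m + 1 + k + 1)) = 0 := by
      have h1 := hle' m (1 + k)
      have h2 := hle' m (1 + k + 1)
      have h3 := hle' (m + 1) k
      have h4 := hle' (m + 1) (k + 1)
      simp only [← add_assoc] at h1 h2 h3 h4
      simp [mul_sub, sub_mul, h1, h2, h3, h4]
    have key' (m k : ℕ) : ((p (m + 1 + k) : A) - p (m + 1 + k + 1)) * (p m - p (m + 1)) = 0 := by
      have := congrArg star (key m k)
      simpa [star_mul, (p _).2.isSelfAdjoint.star_eq] using this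
    intro m n hmn
    rcases lt_or_gt_of_ne hmn with hlt | hlt
    · obtain ⟨k, rfl⟩ := Nat.exists_eq_add_of_le (Nat.succ_le_of_lt hlt)
      exact key m k
    · obtain ⟨k, rfl⟩ := Nat.exists_eq_add_of_le (Nat.succ_le_of_lt hlt)
      exact key' n k

/-- If the corner of a projection is not one-dimensional, it contains a self-adjoint element which
is not a multiple of the projection. -/
theorem IsStarProjection.exists_isSelfAdjoint_not_smul {p : A} (hp : IsStarProjection p)
    (h : ¬ ∀ x, ∃ c : ℂ, p * x * p = c • p) :
    ∃ x : A, IsSelfAdjoint x ∧ x * p = x ∧ ∀ c : ℝ, x ≠ c • p := by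
  by_contra! H
  refine h fun x ↦ ?_
  have hs (y : A) (hy : IsSelfAdjoint y) : ∃ c : ℝ, p * y * p = c • p := by
    refine H _ ?_ (by rw [mul_assoc, hp.isIdempotentElem])
    simpa [hp.isSelfAdjoint.star_eq] using hy.conjugate p
  obtain ⟨c, hc⟩ := hs _ (realPart x).2
  obtain ⟨d, hd⟩ := hs _ (imaginaryPart x).2
  refine ⟨c + Complex.I * d, ?_⟩
  conv_lhs => rw [← realPart_add_I_smul_imaginaryPart x]
  rw [mul_add, add_mul, hc, mul_smul_comm, smul_mul_assoc, hd, add_smul, mul_smul]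
  simp

/-- In the absence of infinite orthogonal sequences, every projection is a finite sum of
projections with one-dimensional corner. -/
theorem IsStarProjection.mem_closure_minimal_of_no_orthogonal_seq
    (h : ¬ ∃ a : ℕ → A, (∀ n, IsSelfAdjoint (a n)) ∧ (∀ n, a n ≠ 0) ∧
      Pairwise fun m n ↦ a m * a n = 0) {p : A} (hp : IsStarProjection p) :
    p ∈ AddSubmonoid.closure
      {p : A | IsStarProjection p ∧ ∀ x, ∃ c : ℂ, p * x * p = c • p} := by
  suffices H : ∀ p : {p : A // IsStarProjection p}, (p : A) ∈ AddSubmonoid.closure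
      {p : A | IsStarProjection p ∧ ∀ x, ∃ c : ℂ, p * x * p = c • p} from H ⟨p, hp⟩
  intro p
  induction p using (wellFounded_isStarProjection_of_no_orthogonal_seq h).induction with
  | _ p ih =>
    obtain ⟨p, hp⟩ := p
    by_cases hmin : ∀ x, ∃ c : ℂ, p * x * p = c • p
    · exact AddSubmonoid.subset_closure ⟨hp, hmin⟩
    · obtain ⟨x, hx, hxp, hxc⟩ := hp.exists_isSelfAdjoint_not_smul hmin
      have hfin : (spectrum ℝ x).Finite := by
        by_contra hinf
        exact h (hx.exists_orthogonal_seq_of_infinite_spectrum hinf)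
      obtain ⟨t, q, ht, hq, hq0, hxq, hqx⟩ := hx.exists_spectral_projection_of_finite_spectrum
        (by simpa using hxc 0) hfin
      have hq' : q = t⁻¹ • (q * x) := by rw [hqx, smul_smul, inv_mul_cancel₀ ht, one_smul]
      have hqp : q * p = q := by
        rw [hq', smul_mul_assoc, mul_assoc, hxp]
      have hne : q ≠ p := by
        rintro rfl
        exact hxc t (hxp.symm.trans hxq)
      have hpq : IsStarProjection (p - q) := hq.sub_of_mul_eq_left hp hqp
      change p ∈ _
      rw [← add_sub_cancel q p]
      refine add_mem (ih ⟨q, hq⟩ ⟨hqp, fun h ↦ hne (congrArg Subtype.val h)⟩)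
        (ih ⟨p - q, hpq⟩ ⟨?_, fun h ↦ hq0 ?_⟩)
      · rw [sub_mul, hqp, hp.isIdempotentElem]
      · simpa using congrArg Subtype.val h

/-- The corner between two projections with one-dimensional corners is at most
one-dimensional. -/
theorem IsStarProjection.exists_forall_mul_mul_eq_smul {p q : A} (hp : IsStarProjection p)
    (hq : IsStarProjection q) (hpm : ∀ x, ∃ c : ℂ, p * x * p = c • p)
    (hqm : ∀ x, ∃ c : ℂ, q * x * q = c • q) :
    ∃ v : A, ∀ x, ∃ c : ℂ, p * x * q = c • v := by
  by_cases h0 : ∀ x, p * x * q = 0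
  · exact ⟨0, fun x ↦ ⟨0, by simp [h0]⟩⟩
  push Not at h0
  obtain ⟨x₀, hx₀⟩ := h0
  refine ⟨p * x₀ * q, fun y ↦ ?_⟩
  obtain ⟨c, hc⟩ := hpm (x₀ * q * star x₀)
  obtain ⟨d, hd⟩ := hqm (star x₀ * p * y)
  have hq' := hq.isIdempotentElem.eq
  have hp' := hp.isIdempotentElem.eq
  have hstar : star (p * x₀ * q) = q * star x₀ * p := by
    simp [hp.isSelfAdjoint.star_eq, hq.isSelfAdjoint.star_eq, mul_assoc]
  have hvv : (p * x₀ * q) * star (p * x₀ * q) = c • p := by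
    rw [hstar, ← hc]
    simp only [mul_assoc]
    rw [← mul_assoc q q, hq']
  have hc0 : c ≠ 0 := by
    rintro rfl
    rw [zero_smul, CStarRing.mul_star_self_eq_zero_iff] at hvv
    exact hx₀ hvv
  refine ⟨c⁻¹ * d, ?_⟩
  have h1 : c • (p * y * q) = d • (p * x₀ * q) := by
    calc c • (p * y * q) = (c • p) * (y * q) := by rw [smul_mul_assoc, mul_assoc]
      _ = p * x₀ * (q * (star x₀ * p * y) * q) := by
        rw [← hc]
        simp only [mul_assoc]
      _ = d • (p * x₀ * q) := by rw [hd, mul_smul_comm]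
  rw [mul_smul, ← h1, smul_smul, inv_mul_cancel₀ hc0, one_smul]

/-- An infinite-dimensional C⋆-algebra contains an infinite sequence of pairwise orthogonal nonzero
self-adjoint elements. -/
theorem CStarAlgebra.exists_orthogonal_seq (hinf : ¬ FiniteDimensional ℂ A) :
    ∃ a : ℕ → A, (∀ n, IsSelfAdjoint (a n)) ∧ (∀ n, a n ≠ 0) ∧
      Pairwise fun m n ↦ a m * a n = 0 := by
  by_contra h
  apply hinf
  set S := {p : A | IsStarProjection p ∧ ∀ x, ∃ c : ℂ, p * x * p = c • p} with hS
  let L (p q : A) : A →ₗ[ℂ] A := LinearMap.mulLeft ℂ p ∘ₗ LinearMap.mulRight ℂ q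
  have hone : (1 : A) ∈ AddSubmonoid.closure S :=
    (IsStarProjection.one A).mem_closure_minimal_of_no_orthogonal_seq h
  have hadd (f g k : A →ₗ[ℂ] A) (hk : k = f + g) (hf : FiniteDimensional ℂ f.range)
      (hg : FiniteDimensional ℂ g.range) : FiniteDimensional ℂ k.range := by
    refine Submodule.finiteDimensional_of_le (S₂ := f.range ⊔ g.range) ?_
    rintro _ ⟨x, rfl⟩
    rw [hk]
    exact Submodule.add_mem_sup ⟨x, rfl⟩ ⟨x, rfl⟩
  have hzero (k : A →ₗ[ℂ] A) (hk : k = 0) : FiniteDimensional ℂ k.range := by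
    subst hk
    rw [LinearMap.range_zero]
    infer_instance
  have key : ∀ p ∈ AddSubmonoid.closure S, ∀ q ∈ AddSubmonoid.closure S,
      FiniteDimensional ℂ (L p q).range := by
    intro p hp q hq
    induction hp using AddSubmonoid.closure_induction with
    | zero => exact hzero _ (by ext; simp [L])
    | add p₁ p₂ _ _ h₁ h₂ => exact hadd _ _ _ (by ext; simp [L, add_mul]) h₁ h₂
    | mem p hp =>
      induction hq using AddSubmonoid.closure_induction with
      | zero => exact hzero _ (by ext; simp [L])
      | add p₁ p₂ _ _ h₁ h₂ => exact hadd _ _ _ (by ext; simp [L, mul_add]) h₁ h₂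
      | mem q hq =>
        obtain ⟨v, hv⟩ := hp.1.exists_forall_mul_mul_eq_smul hq.1 hp.2 hq.2
        refine Submodule.finiteDimensional_of_le (S₂ := Submodule.span ℂ {v}) ?_
        rintro _ ⟨x, rfl⟩
        obtain ⟨c, hc⟩ := hv x
        refine Submodule.mem_span_singleton.2 ⟨c, ?_⟩
        simp [L, ← hc, mul_assoc]
  have h1 := key 1 hone 1 hone
  have hL : L 1 1 = LinearMap.id := by ext; simp [L]
  rw [hL, LinearMap.range_id] at h1
  exact Submodule.topEquiv.finiteDimensional

end CStarAlgebra

/-- There is a continuum of infinite subsets of `ℕ` with pairwise finite intersections. -/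
theorem exists_almost_disjoint_family :
    ∃ N : (ℕ → Bool) → Set ℕ, (∀ f, (N f).Infinite) ∧
      Pairwise fun f g ↦ (N f ∩ N g).Finite := by
  let c (f : ℕ → Bool) (n : ℕ) : ℕ := Encodable.encode ((List.range n).map f)
  have hc {f g : ℕ → Bool} {m n : ℕ} (h : c f m = c g n) : m = n ∧ ∀ k < m, f k = g k := by
    have h1 := Encodable.encode_injective h
    have h2 : m = n := by simpa using congrArg List.length h1
    subst h2
    exact ⟨rfl, fun k hk ↦ (List.map_inj_left.1 h1) k (List.mem_range.2 hk)⟩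
  refine ⟨fun f ↦ Set.range (c f), fun f ↦ Set.infinite_range_of_injective fun m n h ↦ (hc h).1,
    fun f g hfg ↦ ?_⟩
  obtain ⟨k, hk⟩ := Function.ne_iff.1 hfg
  refine ((Set.finite_Iic k).image (c f)).subset ?_
  rintro _ ⟨⟨m, rfl⟩, ⟨n, hn⟩⟩
  refine ⟨m, ?_, rfl⟩
  by_contra hm
  exact hk ((hc hn.symm).2 k (not_le.1 hm))

/-- A bounded functional that is insensitive to finite modifications of the index set vanishes at
all but countably many members of an almost disjoint family. -/
theorem countable_support_of_almost_disjoint {E ι : Type*} [NormedAddCommGroup E] [NormedSpace ℂ E]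
    (ψ : E →L[ℂ] ℂ) (β : Set ℕ → E)
    (hfin : ∀ N D : Set ℕ, D.Finite → ψ (β (N \ D)) = ψ (β N))
    (hβ : ∀ (s : Finset ι) (N : ι → Set ℕ) (c : ι → ℂ),
      (∀ i ∈ s, ∀ j ∈ s, i ≠ j → Disjoint (N i) (N j)) → (∀ i, ‖c i‖ ≤ 1) →
      ‖∑ i ∈ s, c i • β (N i)‖ ≤ 1)
    (N : ι → Set ℕ) (hN : Pairwise fun i j ↦ (N i ∩ N j).Finite) :
    {i | ψ (β (N i)) ≠ 0}.Countable := by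
  have hsum : Summable fun i ↦ ‖ψ (β (N i))‖ := by
    refine summable_of_sum_le (c := ‖ψ‖) (fun _ ↦ norm_nonneg _) fun s ↦ ?_
    set D : Set ℕ := ⋃ p ∈ {p : ι × ι | p.1 ∈ s ∧ p.2 ∈ s ∧ p.1 ≠ p.2}, N p.1 ∩ N p.2 with hD
    have hDfin : D.Finite := by
      refine Set.Finite.biUnion ?_ fun p hp ↦ hN hp.2.2
      exact (s ×ˢ s).finite_toSet.subset fun p hp ↦ by
        simpa using ⟨hp.1, hp.2.1⟩
    have hc (z : ℂ) : ∃ c : ℂ, ‖c‖ ≤ 1 ∧ c * z = ‖z‖ := by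
      by_cases hz : z = 0
      · exact ⟨0, by simp, by simp [hz]⟩
      · have hz' : (‖z‖ : ℂ) ≠ 0 := by simpa using hz
        refine ⟨(starRingEnd ℂ) z / ‖z‖, ?_, ?_⟩
        · simp [div_self_le_one]
        · rw [div_mul_eq_mul_div, Complex.conj_mul', sq, mul_div_assoc, div_self hz', mul_one]
    choose c hc1 hc2 using fun i ↦ hc (ψ (β (N i)))
    have hdisj : ∀ i ∈ s, ∀ j ∈ s, i ≠ j → Disjoint (N i \ D) (N j \ D) := by
      intro i hi j hj hij
      refine Set.disjoint_left.2 fun n hni hnj ↦ hni.2 ?_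
      exact Set.mem_biUnion (x := (i, j)) ⟨hi, hj, hij⟩ ⟨hni.1, hnj.1⟩
    have h1 := (ψ.le_opNorm _).trans (mul_le_of_le_one_right (norm_nonneg ψ)
      (hβ s (fun i ↦ N i \ D) c hdisj hc1))
    have h2 : ψ (∑ i ∈ s, c i • β (N i \ D)) = ((∑ i ∈ s, ‖ψ (β (N i))‖ : ℝ) : ℂ) := by
      rw [map_sum, Complex.ofReal_sum]
      refine Finset.sum_congr rfl fun i _ ↦ ?_
      rw [map_smul, smul_eq_mul, hfin _ _ hDfin, hc2]
    rw [h2, Complex.norm_real, Real.norm_eq_abs] at h1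
    exact (le_abs_self _).trans h1
  refine hsum.countable_support.mono fun i hi ↦ ?_
  simpa using hi

/-- A linear combination with coefficients in the unit disc of pairwise orthogonal self-adjoint
contractions is a contraction. -/
theorem norm_sum_smul_le_one_of_orthogonal {B ι : Type*} [CStarAlgebra B] (s : Finset ι)
    (T : ι → B) (c : ι → ℂ) (hT : ∀ i ∈ s, IsSelfAdjoint (T i)) (hT1 : ∀ i ∈ s, ‖T i‖ ≤ 1)
    (hc : ∀ i, ‖c i‖ ≤ 1) (horth : ∀ i ∈ s, ∀ j ∈ s, i ≠ j → T i * T j = 0) :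
    ‖∑ i ∈ s, c i • T i‖ ≤ 1 := by
  classical
  suffices H : IsStarNormal (∑ i ∈ s, c i • T i) ∧ ‖∑ i ∈ s, c i • T i‖ ≤ 1 from H.2
  induction s using Finset.induction with
  | empty => simp [IsStarNormal.zero]
  | insert j s hj ih =>
    obtain ⟨hn, hle⟩ := ih (fun i hi ↦ hT i (by simp [hi])) (fun i hi ↦ hT1 i (by simp [hi]))
      (fun i hi k hk ↦ horth i (by simp [hi]) k (by simp [hk]))
    have hne {i : ι} (hi : i ∈ s) : i ≠ j := by rintro rfl; exact hj hi
    have h1 : T j * ∑ i ∈ s, c i • T i = 0 := by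
      rw [Finset.mul_sum]
      refine Finset.sum_eq_zero fun i hi ↦ ?_
      rw [mul_smul_comm, horth j (by simp) i (by simp [hi]) (hne hi).symm, smul_zero]
    have h2 : (∑ i ∈ s, c i • T i) * T j = 0 := by
      rw [Finset.sum_mul]
      refine Finset.sum_eq_zero fun i hi ↦ ?_
      rw [smul_mul_assoc, horth i (by simp [hi]) j (by simp) (hne hi), smul_zero]
    have hTj := hT j (by simp)
    have h3 : T j * star (∑ i ∈ s, c i • T i) = 0 := by
      simpa [hTj.star_eq] using congrArg star h2
    have h4 : star (∑ i ∈ s, c i • T i) * T j = 0 := by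
      simpa [hTj.star_eq] using congrArg star h1
    have hcT : IsStarNormal (c j • T j) := ⟨by
      simp [hTj.star_eq, commute_iff_eq, smul_smul, mul_comm]⟩
    rw [Finset.sum_insert hj]
    refine ⟨⟨?_⟩, ?_⟩
    · have := hcT.star_comm_self.eq
      have := hn.star_comm_self.eq
      simp only [commute_iff_eq, star_add, add_mul, mul_add, star_smul, hTj.star_eq] at *
      simp only [smul_mul_assoc, mul_smul_comm, h1, h2, h3, h4] at *
      simp_all
    · rw [hcT.norm_add_eq_max hn (by simp [commute_iff_eq, h1, h2]) (by simp [h1])]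
      refine max_le ?_ hle
      rw [norm_smul]
      exact mul_le_one₀ (hc j) (norm_nonneg _) (hT1 j (by simp))

section Hilbert

open Filter Topology

variable {H : Type*} [NormedAddCommGroup H] [InnerProductSpace ℂ H]

/-- A sequence of pairwise orthogonal self-adjoint contractions is summable in the strong operator
topology. -/
theorem exists_forall_hasSum_apply_of_orthogonal [CompleteSpace H]
    (T : ℕ → H →L[ℂ] H)
    (hT : ∀ n, IsSelfAdjoint (T n)) (hT1 : ∀ n, ‖T n‖ ≤ 1)
    (horth : Pairwise fun m n ↦ T m * T n = 0) :
    ∃ b : H →L[ℂ] H, ∀ ξ, HasSum (fun n ↦ T n ξ) (b ξ) := by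
  have hbound (s : Finset ℕ) : ‖∑ n ∈ s, T n‖ ≤ 1 := by
    simpa using norm_sum_smul_le_one_of_orthogonal s T (fun _ ↦ 1) (fun n _ ↦ hT n)
      (fun n _ ↦ hT1 n) (by simp) (fun m _ n _ h ↦ horth h)
  have hV : OrthogonalFamily ℂ (fun n ↦ (T n).range) fun n ↦ (T n).range.subtypeₗᵢ := by
    rintro m n hmn ⟨_, ξ, rfl⟩ ⟨_, η, rfl⟩
    have h := congrArg (fun S : H →L[ℂ] H ↦ inner ℂ ξ (S η)) (horth hmn)
    simpa [← ContinuousLinearMap.adjoint_inner_right,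
      ← ContinuousLinearMap.star_eq_adjoint, (hT m).star_eq] using h
  have hsum (ξ : H) : Summable fun n ↦ T n ξ := by
    refine (hV.summable_iff_norm_sq_summable fun n ↦ ⟨T n ξ, ⟨ξ, rfl⟩⟩).2 ?_
    refine summable_of_sum_le (c := ‖ξ‖ ^ 2) (fun _ ↦ by positivity) fun s ↦ ?_
    rw [← hV.norm_sum]
    have h := (∑ n ∈ s, T n).le_of_opNorm_le (hbound s) ξ
    rw [_root_.sum_apply, one_mul] at h
    exact pow_le_pow_left₀ (norm_nonneg _) h 2
  have htend : Tendsto (fun (s : Finset ℕ) ξ ↦ (∑ n ∈ s, T n) ξ) atTop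
      (𝓝 fun ξ ↦ ∑' n, T n ξ) := by
    rw [tendsto_pi_nhds]
    intro ξ
    simpa [HasSum] using (hsum ξ).hasSum
  exact ⟨continuousLinearMapOfTendsto _ htend, fun ξ ↦ (hsum ξ).hasSum⟩

/-- The strong sums of a sequence of pairwise orthogonal self-adjoint contractions over all sets of
indices. -/
theorem exists_strong_sums_of_orthogonal [CompleteSpace H]
    (T : ℕ → H →L[ℂ] H)
    (hT : ∀ n, IsSelfAdjoint (T n)) (hT1 : ∀ n, ‖T n‖ ≤ 1)
    (horth : Pairwise fun m n ↦ T m * T n = 0) :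
    ∃ b : Set ℕ → H →L[ℂ] H, ∀ N ξ, HasSum (fun n ↦ N.indicator T n ξ) (b N ξ) := by
  classical
  choose b hb using fun N : Set ℕ ↦ exists_forall_hasSum_apply_of_orthogonal (N.indicator T)
    (fun n ↦ by
      by_cases hn : n ∈ N
      · simpa [hn] using hT n
      · simp [hn])
    (fun n ↦ by
      by_cases hn : n ∈ N
      · simpa [hn] using hT1 n
      · simp [hn])
    (fun m n hmn ↦ by
      by_cases hm : m ∈ N <;> by_cases hn : n ∈ N <;> simp [hm, hn, horth hmn])
  exact ⟨b, hb⟩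

section StrongSums

variable {T : ℕ → H →L[ℂ] H} {b : Set ℕ → H →L[ℂ] H}

/-- Removing finitely many indices changes a strong sum by a finite sum. -/
theorem strong_sum_sdiff (hb : ∀ N ξ, HasSum (fun n ↦ N.indicator T n ξ) (b N ξ)) (N : Set ℕ)
    {D : Set ℕ} (hD : D.Finite) : ∃ s : Finset ℕ, b N = b (N \ D) + ∑ n ∈ s, T n := by
  classical
  have hfin : (N ∩ D).Finite := hD.inter_of_right N
  refine ⟨hfin.toFinset, ?_⟩
  ext ξ
  have h1 : HasSum (fun n ↦ (N ∩ D).indicator T n ξ) (∑ n ∈ hfin.toFinset, T n ξ) := by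
    have hs : ∑ n ∈ hfin.toFinset, T n ξ = ∑ n ∈ hfin.toFinset, (N ∩ D).indicator T n ξ := by
      refine Finset.sum_congr rfl fun n hn ↦ ?_
      rw [Set.indicator_of_mem (by simpa using hn)]
    rw [hs]
    refine hasSum_sum_of_ne_finset_zero fun n hn ↦ ?_
    rw [Set.indicator_of_notMem (by simpa using hn)]
    rfl
  have h2 := (hb (N \ D) ξ).add h1
  refine (hb N ξ).unique ?_
  simp only [_root_.add_apply, _root_.sum_apply]
  refine HasSum.congr_fun h2 fun n ↦ ?_
  by_cases hn : n ∈ N <;> by_cases hd : n ∈ D <;> simp [hn, hd]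

theorem mul_strong_sum (hb : ∀ N ξ, HasSum (fun n ↦ N.indicator T n ξ) (b N ξ))
    (horth : Pairwise fun m n ↦ T m * T n = 0) (N : Set ℕ) (n : ℕ) :
    T n * b N = T n * N.indicator T n := by
  ext ξ
  refine ((T n).hasSum (hb N ξ)).unique ?_
  refine hasSum_single n fun m hm ↦ ?_
  by_cases hmN : m ∈ N
  · simpa [hmN] using congrArg (fun S : H →L[ℂ] H ↦ S ξ) (horth hm.symm)
  · simp [hmN]

theorem strong_sum_mul_of_disjoint (hb : ∀ N ξ, HasSum (fun n ↦ N.indicator T n ξ) (b N ξ))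
    (horth : Pairwise fun m n ↦ T m * T n = 0) {N N' : Set ℕ} (hd : Disjoint N N') :
    b N * b N' = 0 := by
  ext ξ
  refine (hb N (b N' ξ)).unique ?_
  refine HasSum.congr_fun hasSum_zero fun n ↦ ?_
  by_cases hn : n ∈ N
  · have := congrArg (fun S : H →L[ℂ] H ↦ S ξ) (mul_strong_sum hb horth N' n)
    simpa [hn, Set.disjoint_left.1 hd hn] using this
  · simp [hn]

theorem isSelfAdjoint_strong_sum [CompleteSpace H]
    (hb : ∀ N ξ, HasSum (fun n ↦ N.indicator T n ξ) (b N ξ))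
    (hT : ∀ n, IsSelfAdjoint (T n)) (N : Set ℕ) : IsSelfAdjoint (b N) := by
  rw [ContinuousLinearMap.isSelfAdjoint_iff_isSymmetric]
  intro ξ η
  have h1 : HasSum (fun n ↦ inner ℂ ξ (N.indicator T n η)) (inner ℂ ξ (b N η)) :=
    (innerSL ℂ ξ).hasSum (hb N η)
  have h2 : HasSum (fun n ↦ inner ℂ (N.indicator T n ξ) η) (inner ℂ (b N ξ) η) :=
    ((innerSLFlip ℂ η).hasSum (hb N ξ))
  refine h2.unique ?_
  refine HasSum.congr_fun h1 fun n ↦ ?_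
  by_cases hn : n ∈ N
  · simpa [hn] using (ContinuousLinearMap.isSelfAdjoint_iff_isSymmetric.1 (hT n)) ξ η
  · simp [hn]

theorem norm_strong_sum_le_one [CompleteSpace H]
    (hb : ∀ N ξ, HasSum (fun n ↦ N.indicator T n ξ) (b N ξ))
    (hT : ∀ n, IsSelfAdjoint (T n)) (hT1 : ∀ n, ‖T n‖ ≤ 1)
    (horth : Pairwise fun m n ↦ T m * T n = 0) (N : Set ℕ) : ‖b N‖ ≤ 1 := by
  classical
  refine ContinuousLinearMap.opNorm_le_bound _ zero_le_one fun ξ ↦ ?_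
  refine le_of_tendsto (hb N ξ).norm (.of_forall fun s ↦ ?_)
  have h := norm_sum_smul_le_one_of_orthogonal s T (N.indicator 1) (fun n _ ↦ hT n)
    (fun n _ ↦ hT1 n) (fun n ↦ by by_cases hn : n ∈ N <;> simp [hn])
    (fun m _ n _ h ↦ horth h)
  have h' := ContinuousLinearMap.le_of_opNorm_le _ h ξ
  have hs : ∑ n ∈ s, N.indicator T n ξ = (∑ n ∈ s, (N.indicator 1 n : ℂ) • T n) ξ := by
    rw [_root_.sum_apply]
    refine Finset.sum_congr rfl fun n _ ↦ ?_
    by_cases hn : n ∈ N <;> simp [hn]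
  rw [hs]
  simpa using h'

theorem strong_sum_commute (hb : ∀ N ξ, HasSum (fun n ↦ N.indicator T n ξ) (b N ξ))
    {y : H →L[ℂ] H} (hy : ∀ n, y * T n = T n * y) (N : Set ℕ) : y * b N = b N * y := by
  ext ξ
  refine (y.hasSum (hb N ξ)).unique ?_
  refine HasSum.congr_fun (hb N (y ξ)) fun n ↦ ?_
  by_cases hn : n ∈ N
  · simpa [hn] using congrArg (fun S : H →L[ℂ] H ↦ S ξ) (hy n)
  · simp [hn]

end StrongSums

end Hilbert



/-- An infinite-dimensional separable concrete C*-algebra `A ⊆ B(H)` is not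
complemented in the von Neumann algebra `M = A''` it generates: there is no
continuous linear map `P : M → M` with range contained in `A` that fixes `A`
pointwise. -/
theorem separable_cstar_not_complemented_in_double_commutant
    (H : Type*) [NormedAddCommGroup H] [InnerProductSpace ℂ H] [CompleteSpace H]
    (A : StarSubalgebra ℂ (H →L[ℂ] H))
    (hclosed : IsClosed (A : Set (H →L[ℂ] H)))
    (hinf : ¬ FiniteDimensional ℂ A)
    (hsep : TopologicalSpace.SeparableSpace A)
    (M : Subalgebra ℂ (H →L[ℂ] H))
    (hM : M = Subalgebra.centralizer ℂ
      ((Subalgebra.centralizer ℂ (A : Set (H →L[ℂ] H)) : Subalgebra ℂ (H →L[ℂ] H)) :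
        Set (H →L[ℂ] H))) :
    ¬ ∃ P : M →L[ℂ] M,
        (∀ m : M, (P m : H →L[ℂ] H) ∈ A) ∧
        (∀ m : M, (m : H →L[ℂ] H) ∈ A → P m = m) := by
  rintro ⟨P, hPA, hP⟩
  have : IsClosed (A : Set (H →L[ℂ] H)) := hclosed
  obtain ⟨a, ha, ha0, haorth⟩ := CStarAlgebra.exists_orthogonal_seq (A := A) hinf
  let T (n : ℕ) : H →L[ℂ] H := ((‖a n‖⁻¹ : ℝ) • a n : A)
  have hTA (n : ℕ) : T n ∈ A := SetLike.coe_mem _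
  have hT (n : ℕ) : IsSelfAdjoint (T n) :=
    congrArg (Subtype.val : A → H →L[ℂ] H) ((IsSelfAdjoint.all (‖a n‖⁻¹ : ℝ)).smul (ha n))
  have hTnorm (n : ℕ) : ‖T n‖ = 1 := by
    change ‖((‖a n‖⁻¹ : ℝ) • a n : A)‖ = 1
    rw [norm_smul, norm_inv, norm_norm, inv_mul_cancel₀ (norm_ne_zero_iff.2 (ha0 n))]
  have horth : Pairwise fun m n ↦ T m * T n = 0 := by
    intro m n hmn
    have : ((‖a m‖⁻¹ : ℝ) • a m) * ((‖a n‖⁻¹ : ℝ) • a n) = 0 := by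
      rw [smul_mul_assoc, mul_smul_comm, haorth hmn, smul_zero, smul_zero]
    exact congrArg (Subtype.val : A → H →L[ℂ] H) this
  have hT1 (n : ℕ) : ‖T n‖ ≤ 1 := (hTnorm n).le
  obtain ⟨b, hb⟩ := exists_strong_sums_of_orthogonal T hT hT1 horth
  have hAM {x : H →L[ℂ] H} (hx : x ∈ A) : x ∈ M := by
    rw [hM, Subalgebra.mem_centralizer_iff]
    exact fun y hy ↦ ((Subalgebra.mem_centralizer_iff ℂ).1 hy x hx).symm
  have hbM (N : Set ℕ) : b N ∈ M := by
    rw [hM, Subalgebra.mem_centralizer_iff]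
    exact fun y hy ↦ strong_sum_commute hb
      (fun n ↦ ((Subalgebra.mem_centralizer_iff ℂ).1 hy _ (hTA n)).symm) N
  let β (N : Set ℕ) : M := ⟨b N, hbM N⟩
  have hu (n : ℕ) : ∃ u : H, ‖u‖ ≤ 1 ∧ 1 / 2 < ‖T n u‖ := by
    obtain ⟨u, hu, hu'⟩ := (T n).exists_lt_apply_of_lt_opNorm (r := 1 / 2)
      (by rw [hTnorm]; norm_num)
    exact ⟨u, hu.le, hu'⟩
  choose u hu1 hu2 using hu
  let φ (n : ℕ) : (H →L[ℂ] H) →L[ℂ] ℂ :=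
    (innerSL ℂ (T n (u n))).comp (ContinuousLinearMap.apply ℂ H (u n))
  have hφ (n : ℕ) (S : H →L[ℂ] H) : φ n S = inner ℂ (T n (u n)) (S (u n)) := rfl
  have hφle (n : ℕ) (S : H →L[ℂ] H) : ‖φ n S‖ ≤ ‖S‖ := by
    have h1 : ‖T n (u n)‖ ≤ 1 :=
      ((T n).le_of_opNorm_le (hT1 n) _).trans (by simpa using hu1 n)
    have h2 : ‖S (u n)‖ ≤ ‖S‖ :=
      (S.le_opNorm _).trans (mul_le_of_le_one_right (norm_nonneg _) (hu1 n))
    rw [hφ]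
    exact (norm_inner_le_norm _ _).trans
      ((mul_le_of_le_one_left (norm_nonneg _) h1).trans h2)
  have hφb (n : ℕ) (N : Set ℕ) : φ n (b N) = inner ℂ (T n (u n)) (N.indicator T n (u n)) := by
    have hadj (x y : H) : inner ℂ (T n x) y = inner ℂ x (T n y) :=
      (ContinuousLinearMap.isSelfAdjoint_iff_isSymmetric.1 (hT n)) x y
    have := congrArg (fun S : H →L[ℂ] H ↦ S (u n)) (mul_strong_sum hb horth N n)
    rw [hφ, hadj, hadj]
    exact congrArg _ this
  let ψ (n : ℕ) : M →L[ℂ] ℂ :=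
    ((φ n).comp M.toSubmodule.subtypeL).comp (ContinuousLinearMap.id ℂ M - P)
  have hψ (n : ℕ) (m : M) : ψ n m = φ n m - φ n (P m) := by
    rw [← map_sub]
    rfl
  have hψA (n : ℕ) (m : M) (hm : (m : H →L[ℂ] H) ∈ A) : ψ n m = 0 := by
    rw [hψ, hP m hm, sub_self]
  obtain ⟨N, hNinf, hNfin⟩ := exists_almost_disjoint_family
  have hcount (n : ℕ) : {i | ψ n (β (N i)) ≠ 0}.Countable := by
    refine countable_support_of_almost_disjoint (ψ n) β (fun N D hD ↦ ?_)
      (fun s N c hd hc ↦ ?_) N hNfin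
    · obtain ⟨s, hs⟩ := strong_sum_sdiff hb N hD
      have hsA : ∑ n ∈ s, T n ∈ A := sum_mem fun n _ ↦ hTA n
      have : β N = β (N \ D) + ⟨_, hAM hsA⟩ := Subtype.ext hs
      rw [this, map_add, hψA n ⟨_, hAM hsA⟩ hsA, add_zero]
    · have := norm_sum_smul_le_one_of_orthogonal s (fun i ↦ b (N i)) c
        (fun i _ ↦ isSelfAdjoint_strong_sum hb hT _)
        (fun i _ ↦ norm_strong_sum_le_one hb hT hT1 horth _) hc
        (fun i hi j hj hij ↦ strong_sum_mul_of_disjoint hb horth (hd i hi j hj hij))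
      have hcoe : ((∑ i ∈ s, c i • β (N i) : M) : H →L[ℂ] H) = ∑ i ∈ s, c i • b (N i) := by
        simp [β]
      rwa [← hcoe] at this
  let I : Set (ℕ → Bool) := {i | ∀ n, ψ n (β (N i)) = 0}
  have hIc : Iᶜ.Countable := by
    refine (Set.countable_iUnion hcount).mono fun i hi ↦ ?_
    simpa [I] using hi
  have hsepd : ∀ i ∈ I, ∀ j ∈ I, i ≠ j →
      1 / 4 ≤ ‖(P (β (N i)) : H →L[ℂ] H) - P (β (N j))‖ := by
    intro i hi j hj hij
    obtain ⟨n, hni, hnj⟩ : ∃ n ∈ N i, n ∉ N j := by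
      by_contra! h
      exact hNinf i ((hNfin hij).subset fun n hn ↦ ⟨hn, h n hn⟩)
    have h1 : φ n (P (β (N i)) - P (β (N j)) : H →L[ℂ] H) = (‖T n (u n)‖ : ℂ) ^ 2 := by
      have h2 := hi n
      have h3 := hj n
      rw [hψ, sub_eq_zero] at h2 h3
      rw [map_sub, ← h2, ← h3, hφb, hφb, Set.indicator_of_mem hni, Set.indicator_of_notMem hnj]
      simp [inner_self_eq_norm_sq_to_K]
    refine le_trans ?_ (hφle n _)
    rw [h1, norm_pow, Complex.norm_real, norm_norm]
    nlinarith [hu2 n]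
  have hIcount : I.Countable := by
    let p (i : ℕ → Bool) : A := ⟨P (β (N i)), hPA _⟩
    refine Set.PairwiseDisjoint.countable_of_isOpen (s := fun i ↦ Metric.ball (p i) (1 / 8))
      (fun i hi j hj hij ↦ ?_) (fun _ _ ↦ Metric.isOpen_ball)
      (fun i _ ↦ ⟨p i, Metric.mem_ball_self (by norm_num)⟩)
    refine Metric.ball_disjoint_ball ?_
    rw [Subtype.dist_eq, dist_eq_norm]
    exact le_trans (by norm_num) (hsepd i hi j hj hij)
  have huniv : (Set.univ : Set (ℕ → Bool)).Countable := by
    rw [← Set.union_compl_self I]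
    exact hIcount.union hIc
  rw [Set.countable_univ_iff, ← Cardinal.mk_le_aleph0_iff] at huniv
  have : Cardinal.aleph0 < Cardinal.mk (ℕ → Bool) := by
    simpa using Cardinal.aleph0_lt_continuum
  exact huniv.not_gt this
end

section
/- Let H be a complex Hilbert space and let (h_i)_{i∈ℕ} be a sequence of bounded operators on H such that each h_i is positive with ‖h_i‖ = 1 and h_i h_j = 0 whenever i ≠ j. Then for every bounded complex sequence c = (c_i) there is a unique bounded operator T_c on H such that for every ξ ∈ H the family (c_i · h_i ξ)_{i∈ℕ} is summable in H with sum T_c ξ; moreover ‖T_c‖ = sup_i |c_i|, T_c commutes with every bounded operator that commutes with all the h_i (so T_c lies in the double commutant of {h_i : i ∈ ℕ}), and the map c ↦ T_c is a linear isometry of ℓ∞ into B(H). -/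
open scoped InnerProductSpace

section OrthogonalOperators

variable {H : Type*} [NormedAddCommGroup H] [InnerProductSpace ℂ H] [CompleteSpace H]

/-- Self-adjoint operators with vanishing pairwise products have orthogonal ranges. -/
theorem orthogonalFamily_range_of_mul_eq_zero {ι : Type*} {h : ι → H →L[ℂ] H}
    (hsa : ∀ i, IsSelfAdjoint (h i)) (horth : ∀ i j, i ≠ j → h i * h j = 0) :
    OrthogonalFamily ℂ (fun i => (h i).range) (fun i => (h i).range.subtypeₗᵢ) := by
  rintro i j hij ⟨_, x, rfl⟩ ⟨_, y, rfl⟩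
  have hsym := (hsa i).isSymmetric x (h j y)
  have hz : h i (h j y) = 0 := congrArg (fun T : H →L[ℂ] H => T y) (horth i j hij)
  simpa [hz] using hsym

theorem norm_sum_smul_sq_of_mul_eq_zero {ι : Type*} {h : ι → H →L[ℂ] H}
    (hsa : ∀ i, IsSelfAdjoint (h i)) (horth : ∀ i j, i ≠ j → h i * h j = 0)
    (c : ι → ℂ) (ξ : H) (F : Finset ι) :
    ‖∑ i ∈ F, c i • h i ξ‖ ^ 2 = ∑ i ∈ F, ‖c i • h i ξ‖ ^ 2 :=
  (orthogonalFamily_range_of_mul_eq_zero hsa horth).norm_sum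
    (fun i => c i • ⟨h i ξ, ξ, rfl⟩) F

/-- Bessel's inequality for orthogonal self-adjoint contractions. -/
theorem sum_norm_sq_le_of_mul_eq_zero {ι : Type*} {h : ι → H →L[ℂ] H}
    (hsa : ∀ i, IsSelfAdjoint (h i)) (hle : ∀ i, ‖h i‖ ≤ 1)
    (horth : ∀ i j, i ≠ j → h i * h j = 0) (ξ : H) (F : Finset ι) :
    ∑ i ∈ F, ‖h i ξ‖ ^ 2 ≤ ‖ξ‖ ^ 2 := by
  have hsum : ∀ x, ‖∑ i ∈ F, h i x‖ ^ 2 = ∑ i ∈ F, ‖h i x‖ ^ 2 := fun x => by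
    simpa using norm_sum_smul_sq_of_mul_eq_zero hsa horth (fun _ => 1) x F
  rw [← hsum]
  set y := ∑ i ∈ F, h i ξ with hy
  have hhy : ∀ i ∈ F, h i y = h i (h i ξ) := fun i hi => by
    rw [hy, map_sum]
    exact Finset.sum_eq_single_of_mem i hi fun j _ hji =>
      congrArg (fun T : H →L[ℂ] H => T ξ) (horth i j hji.symm)
  have hSy : ‖∑ i ∈ F, h i y‖ ≤ ‖y‖ := by
    refine le_of_sq_le_sq ?_ (norm_nonneg _)
    rw [hsum, hsum]
    refine Finset.sum_le_sum fun i hi => ?_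
    rw [hhy i hi]
    gcongr
    simpa using (h i).le_of_opNorm_le (hle i) (h i ξ)
  have hin : ⟪y, y⟫_ℂ = ⟪ξ, ∑ i ∈ F, h i y⟫_ℂ := by
    conv_lhs => rw [hy, sum_inner]
    rw [inner_sum]
    exact Finset.sum_congr rfl fun i _ => (hsa i).isSymmetric ξ y
  have hyy : ‖y‖ * ‖y‖ ≤ ‖ξ‖ * ‖y‖ := by
    have hself : ‖⟪y, y⟫_ℂ‖ = ‖y‖ * ‖y‖ := by
      rw [inner_self_eq_norm_sq_to_K]
      simp [sq]
    rw [← hself, hin]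
    exact (norm_inner_le_norm _ _).trans (by gcongr)
  nlinarith [norm_nonneg y, norm_nonneg ξ]

theorem norm_sum_smul_le_of_mul_eq_zero {ι : Type*} {h : ι → H →L[ℂ] H}
    (hsa : ∀ i, IsSelfAdjoint (h i)) (hle : ∀ i, ‖h i‖ ≤ 1)
    (horth : ∀ i j, i ≠ j → h i * h j = 0) {c : ι → ℂ} {C : ℝ} (hC : 0 ≤ C)
    (hc : ∀ i, ‖c i‖ ≤ C) (ξ : H) (F : Finset ι) :
    ‖∑ i ∈ F, c i • h i ξ‖ ≤ C * ‖ξ‖ := by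
  refine le_of_sq_le_sq ?_ (by positivity)
  calc ‖∑ i ∈ F, c i • h i ξ‖ ^ 2 = ∑ i ∈ F, ‖c i • h i ξ‖ ^ 2 :=
        norm_sum_smul_sq_of_mul_eq_zero hsa horth c ξ F
    _ ≤ ∑ i ∈ F, C ^ 2 * ‖h i ξ‖ ^ 2 := Finset.sum_le_sum fun i _ => by
        rw [norm_smul, mul_pow]
        gcongr
        exact hc i
    _ ≤ C ^ 2 * ‖ξ‖ ^ 2 := by
        rw [← Finset.mul_sum]
        gcongr
        exact sum_norm_sq_le_of_mul_eq_zero hsa hle horth ξ F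
    _ = (C * ‖ξ‖) ^ 2 := (mul_pow _ _ _).symm

theorem summable_smul_of_mul_eq_zero {ι : Type*} {h : ι → H →L[ℂ] H}
    (hsa : ∀ i, IsSelfAdjoint (h i)) (hle : ∀ i, ‖h i‖ ≤ 1)
    (horth : ∀ i j, i ≠ j → h i * h j = 0) {c : ι → ℂ} {C : ℝ} (hC : 0 ≤ C)
    (hc : ∀ i, ‖c i‖ ≤ C) (ξ : H) :
    Summable fun i => c i • h i ξ := by
  let v : ∀ i, (h i).range := fun i => ⟨c i • h i ξ, c i • ξ, map_smul (h i) (c i) ξ⟩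
  suffices hv : Summable fun i => ‖v i‖ ^ 2 from
    ((orthogonalFamily_range_of_mul_eq_zero hsa horth).summable_iff_norm_sq_summable v).2 hv
  refine summable_of_sum_le (c := (C * ‖ξ‖) ^ 2) (fun _ => by positivity) fun F => ?_
  refine (norm_sum_smul_sq_of_mul_eq_zero hsa horth c ξ F).symm.le.trans ?_
  gcongr
  exact norm_sum_smul_le_of_mul_eq_zero hsa hle horth hC hc ξ F

end OrthogonalOperators


/-- Given a sequence of pairwise orthogonal positive norm-one operators `h i` on a
complex Hilbert space `H`, every bounded sequence `c` gives rise to a unique bounded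
operator `T_c` with `T_c ξ = ∑ i, c i • h i ξ` (sum convergent in `H`); moreover
`‖T_c‖ = sup_i |c i|`, `T_c` commutes with every operator commuting with all `h i`
(so it lies in the double commutant of the `h i`), and `c ↦ T_c` is a linear
isometry of `ℓ∞` into `B(H)`. -/
theorem ell_infty_embedding_of_orthogonal_positives
    (H : Type*) [NormedAddCommGroup H] [InnerProductSpace ℂ H] [CompleteSpace H]
    (h : ℕ → H →L[ℂ] H)
    (hpos : ∀ i : ℕ, (h i).IsPositive)
    (hnorm : ∀ i : ℕ, ‖h i‖ = 1)
    (horth : ∀ i j : ℕ, i ≠ j → h i * h j = 0) :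
    ∃ Φ : lp (fun _ : ℕ => ℂ) (⊤ : ENNReal) →ₗᵢ[ℂ] (H →L[ℂ] H),
      ∀ c : lp (fun _ : ℕ => ℂ) (⊤ : ENNReal),
        (∀ ξ : H, HasSum (fun i : ℕ => c i • h i ξ) (Φ c ξ)) ∧
        (∀ T : H →L[ℂ] H, (∀ ξ : H, HasSum (fun i : ℕ => c i • h i ξ) (T ξ)) → T = Φ c) ∧
        (‖Φ c‖ = ⨆ i : ℕ, ‖c i‖) ∧
        (∀ S : H →L[ℂ] H, (∀ i : ℕ, Commute S (h i)) → Commute S (Φ c)) := by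
  have hsa : ∀ i, IsSelfAdjoint (h i) := fun i => (hpos i).isSelfAdjoint
  have hle : ∀ i, ‖h i‖ ≤ 1 := fun i => (hnorm i).le
  have hc : ∀ (c : lp (fun _ : ℕ => ℂ) (⊤ : ENNReal)) (i : ℕ), ‖c i‖ ≤ ‖c‖ :=
    fun c i => lp.norm_apply_le_norm ENNReal.top_ne_zero c i
  have hs : ∀ (c : lp (fun _ : ℕ => ℂ) (⊤ : ENNReal)) (ξ : H),
      HasSum (fun i => c i • h i ξ) (∑' i, c i • h i ξ) := fun c ξ =>
    (summable_smul_of_mul_eq_zero hsa hle horth (norm_nonneg c) (hc c) ξ).hasSum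
  let T : lp (fun _ : ℕ => ℂ) (⊤ : ENNReal) → H →L[ℂ] H := fun c =>
    LinearMap.mkContinuous
      { toFun := fun ξ => ∑' i, c i • h i ξ
        map_add' := fun ξ η => (hs c (ξ + η)).unique <| by
          simpa using (hs c ξ).add (hs c η)
        map_smul' := fun a ξ => (hs c (a • ξ)).unique <| by
          simpa [smul_comm a] using (hs c ξ).const_smul a }
      ‖c‖ fun ξ => le_of_tendsto (hs c ξ).norm <| Filter.Eventually.of_forall fun F =>
        norm_sum_smul_le_of_mul_eq_zero hsa hle horth (norm_nonneg c) (hc c) ξ F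
  have hT : ∀ c ξ, HasSum (fun i => c i • h i ξ) (T c ξ) := hs
  have hTj : ∀ c j ξ, T c (h j ξ) = c j • h j (h j ξ) := fun c j ξ => by
    refine (hT c (h j ξ)).unique (hasSum_single j fun i hij => ?_)
    have hz : h i (h j ξ) = 0 := congrArg (fun T : H →L[ℂ] H => T ξ) (horth i j hij)
    rw [hz, smul_zero]
  have hTnorm : ∀ c, ‖T c‖ = ‖c‖ := fun c => by
    refine le_antisymm (LinearMap.mkContinuous_norm_le _ (norm_nonneg c) _) ?_
    refine lp.norm_le_of_forall_le (norm_nonneg _) fun j => ?_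
    have hmul : T c * h j = c j • (h j * h j) := ContinuousLinearMap.ext (hTj c j)
    calc ‖c j‖ = ‖T c * h j‖ := by
          rw [hmul, norm_smul, (hsa j).norm_mul_self, hnorm]; simp
      _ ≤ ‖T c‖ * ‖h j‖ := norm_mul_le _ _
      _ = ‖T c‖ := by rw [hnorm, mul_one]
  refine ⟨⟨{ toFun := T, map_add' := fun c d => ?_, map_smul' := fun a c => ?_ }, hTnorm⟩,
    fun c => ⟨hT c, fun S hS => ?_, (hTnorm c).trans (lp.norm_eq_ciSup c), fun S hS => ?_⟩⟩
  · ext ξ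
    exact (hT (c + d) ξ).unique <| by simpa [add_smul] using (hT c ξ).add (hT d ξ)
  · ext ξ
    exact (hT (a • c) ξ).unique <| by simpa [mul_smul] using (hT c ξ).const_smul a
  · ext ξ
    exact (hS ξ).unique (hT c ξ)
  · ext ξ
    refine ((hT c ξ).mapL S).unique ?_
    have hcomm : ∀ i, S (c i • h i ξ) = c i • h i (S ξ) := fun i => by
      rw [map_smul]
      exact congrArg (fun R : H →L[ℂ] H => c i • R ξ) (hS i)
    simp only [hcomm]
    exact hT c (S ξ)
end
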